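/- For every integer r ≥ 3 and every real ε > 0 there exists an integer N such that for every integer n ≥ N: (a) every twin-free K_r-saturated graph on n vertices has at least (r+2-ε)·n edges, and (b) there exists a twin-free K_r-saturated graph on n vertices with at most (r+3+ε)·n edges. -/

import Mathlib

open SimpleGraph

/-- `G` is `K_r`-saturated: `G` contains no `r`-clique, but adding any missing edge
creates an `r`-clique. -/
def Ksat (r : ℕ) {V : Type*} (G : SimpleGraph V) : Prop :=
  G.CliqueFree r ∧ ∀ u v : V, u ≠ v → ¬ G.Adj u v →
    ¬ (G ⊔ fromEdgeSet {s(u, v)}).CliqueFree r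

/-- `G` is twin-free: distinct vertices have distinct neighbourhoods. -/
def TwinFree {V : Type*} (G : SimpleGraph V) : Prop :=
  ∀ u v : V, G.neighborSet u = G.neighborSet v → u = v

/-- Minimum degree of `G` is at least `t`. -/
def MinDegGe {V : Type*} (G : SimpleGraph V) (t : ℕ) : Prop :=
  ∀ v : V, t ≤ (G.neighborSet v).ncard

/-- Every pair of distinct twins has a common neighbour of degree exactly `t`. -/
def TwinCond {V : Type*} (G : SimpleGraph V) (t : ℕ) : Prop :=
  ∀ u v : V, u ≠ v → G.neighborSet u = G.neighborSet v →
    ∃ w : V, (G.neighborSet w).ncard = t ∧ G.Adj w u ∧ G.Adj w v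

/-- An `(r,t)`-system. -/
def IsRTSystem (r t : ℕ) {V : Type*} [DecidableEq V] (H : SimpleGraph V)
    (F : Finset (Finset V)) : Prop :=
  H.CliqueFree r ∧
  (∀ S ∈ F, S.card = t ∧
    (H.induce (S : Set V)).CliqueFree (r - 1) ∧
    ∀ v : V, v ∉ S → ¬ (H.induce ((insert v S : Finset V) : Set V)).CliqueFree (r - 1)) ∧
  (∀ S ∈ F, ∀ T ∈ F, S ≠ T → ¬ (H.induce ((S ∩ T : Finset V) : Set V)).CliqueFree (r - 2))

/-- A maximal `(r,t)`-system. -/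
def IsMaxRTSystem (r t : ℕ) {V : Type*} [DecidableEq V] (H : SimpleGraph V)
    (F : Finset (Finset V)) : Prop :=
  IsRTSystem r t H F ∧
  ∀ u v : V, u ≠ v → ¬ H.Adj u v →
    ¬ (H ⊔ fromEdgeSet {s(u, v)}).CliqueFree r ∨
    ∃ S ∈ F, ¬ (((H ⊔ fromEdgeSet {s(u, v)}).induce (S : Set V)).CliqueFree (r - 1))

/-- A `(3,t)`-system. -/
def Is3TSystem (t : ℕ) {V : Type*} [DecidableEq V] (H : SimpleGraph V)
    (F : Finset (Finset V)) : Prop :=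
  H.CliqueFree 3 ∧
  (∀ S ∈ F, S.card = t ∧
    (∀ u ∈ S, ∀ v ∈ S, ¬ H.Adj u v) ∧
    (∀ v : V, v ∉ S → ∃ u ∈ S, H.Adj v u)) ∧
  (∀ S ∈ F, ∀ T ∈ F, S ≠ T → (S ∩ T).Nonempty)

/-- A maximal `(3,t)`-system. -/
def IsMax3TSystem (t : ℕ) {V : Type*} [DecidableEq V] (H : SimpleGraph V)
    (F : Finset (Finset V)) : Prop :=
  Is3TSystem t H F ∧
  ∀ u v : V, u ≠ v → ¬ H.Adj u v →
    ¬ (H ⊔ fromEdgeSet {s(u, v)}).CliqueFree 3 ∨ ∃ S ∈ F, u ∈ S ∧ v ∈ S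

noncomputable def s3 (t m : ℕ) : ℕ :=
  sSup {a : ℕ | ∃ (H : SimpleGraph (Fin m)) (F : Finset (Finset (Fin m))),
    Is3TSystem t H F ∧ F.card = a}

noncomputable def ePrime (r t s : ℕ) : ℕ :=
  sInf {e : ℕ | ∃ (m : ℕ) (H : SimpleGraph (Fin m)) (F : Finset (Finset (Fin m))),
    IsMaxRTSystem r t H F ∧ F.card = s ∧ H.edgeSet.ncard = e}

noncomputable def e3min (t s : ℕ) : ℕ :=
  sInf {e : ℕ | ∃ (m : ℕ) (H : SimpleGraph (Fin m)) (F : Finset (Finset (Fin m))),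
    Is3TSystem t H F ∧ F.card = s ∧ H.edgeSet.ncard = e}

section SaturationBasics

variable {V : Type*} {G : SimpleGraph V} {k : ℕ}

theorem not_cliqueFree_sup_edge_iff [DecidableEq V] (hG : G.CliqueFree (k + 2)) {u v : V}
    (huv : u ≠ v) :
    ¬ (G ⊔ fromEdgeSet {s(u, v)}).CliqueFree (k + 2) ↔
      ∃ Q : Finset V, G.IsNClique k Q ∧ ∀ q ∈ Q, G.Adj u q ∧ G.Adj v q := by
  constructor
  · intro h
    simp only [CliqueFree, not_forall, not_not] at h
    obtain ⟨t, ht⟩ := h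
    have hadj : ∀ x ∈ t, ∀ y ∈ t, x ≠ y → G.Adj x y ∨ s(x, y) = s(u, v) := by
      intro x hx y hy hxy
      have := ht.1 hx hy hxy
      rw [sup_adj, fromEdgeSet_adj] at this
      rcases this with h | h
      · exact .inl h
      · exact .inr h.1
    have hmem : u ∈ t ∧ v ∈ t := by
      by_contra hn
      refine hG t ⟨fun x hx y hy hxy => (hadj x hx y hy hxy).resolve_right fun he => ?_, ht.2⟩
      rcases Sym2.eq_iff.1 he with ⟨rfl, rfl⟩ | ⟨rfl, rfl⟩
      · exact hn ⟨hx, hy⟩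
      · exact hn ⟨hy, hx⟩
    refine ⟨(t.erase u).erase v, ⟨fun x hx y hy hxy => ?_, ?_⟩, fun q hq => ?_⟩
    · simp only [Finset.coe_erase, Set.mem_sdiff, Finset.mem_coe, Set.mem_singleton_iff] at hx hy
      refine (hadj x hx.1.1 y hy.1.1 hxy).resolve_right fun he => ?_
      rcases Sym2.eq_iff.1 he with ⟨rfl, rfl⟩ | ⟨rfl, rfl⟩ <;> simp_all
    · rw [Finset.card_erase_of_mem (by simp [huv.symm, hmem.2]),
        Finset.card_erase_of_mem hmem.1, ht.2]
      rfl
    · simp only [Finset.mem_erase] at hq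
      refine ⟨(hadj u hmem.1 q hq.2.2 (Ne.symm hq.2.1)).resolve_right fun he => ?_,
        (hadj v hmem.2 q hq.2.2 (Ne.symm hq.1)).resolve_right fun he => ?_⟩ <;>
      rcases Sym2.eq_iff.1 he with ⟨h1, h2⟩ | ⟨h1, h2⟩ <;> simp_all
  · rintro ⟨Q, hQ, hadj⟩ hfree
    have hv : (G ⊔ fromEdgeSet {s(u, v)}).IsNClique (k + 1) (insert v Q) :=
      (hQ.mono le_sup_left).insert fun q hq => Or.inl (hadj q hq).2
    refine hfree _ (hv.insert (a := u) fun q hq => ?_)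
    rcases Finset.mem_insert.1 hq with rfl | hq
    · exact Or.inr (by simp [huv])
    · exact Or.inl (hadj q hq).1

theorem ksat_iff :
    Ksat (k + 2) G ↔ G.CliqueFree (k + 2) ∧ ∀ u v : V, u ≠ v → ¬ G.Adj u v →
      ∃ Q : Finset V, G.IsNClique k Q ∧ ∀ q ∈ Q, G.Adj u q ∧ G.Adj v q := by
  classical
  refine and_congr_right fun hG => ?_
  refine forall₄_congr fun u v huv _ => not_cliqueFree_sup_edge_iff hG huv

/-- The common neighbourhood of two adjacent vertices contains no large clique. -/
theorem not_isNClique_of_adj [DecidableEq V] (hG : G.CliqueFree (k + 2)) {u v : V}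
    (huv : G.Adj u v) {Q : Finset V} (hQ : G.IsNClique k Q) (hu : ∀ q ∈ Q, G.Adj u q)
    (hv : ∀ q ∈ Q, G.Adj v q) : False := by
  refine hG _ ((hQ.insert hv).insert (a := u) fun q hq => ?_)
  rcases Finset.mem_insert.1 hq with rfl | hq
  · exact huv
  · exact hu q hq

end SaturationBasics

/-- A weak form of Bollobás' set-pairs inequality that tolerates a bounded number of
exceptions in every row. -/
theorem card_le_of_set_pairs {ι β : Type*} [DecidableEq β] {d q : ℕ} (Q : ι → Finset β) (p : ℕ) :
    ∀ (I : Finset ι) (P : ι → Finset β), (∀ i ∈ I, (P i).card ≤ p) → (∀ i ∈ I, (Q i).card ≤ q) →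
      (∀ i ∈ I, Disjoint (P i) (Q i)) →
      (∀ i ∈ I, (I.filter fun j => Disjoint (P j) (Q i)).card ≤ d) →
      I.card ≤ d * (q + 1) ^ p := by
  classical
  induction p with
  | zero =>
    intro I P hP hQ hd hex
    rcases I.eq_empty_or_nonempty with rfl | ⟨i, hi⟩
    · simp
    · have := hex i hi
      rw [Finset.filter_true_of_mem] at this
      · simpa using this
      · intro j hj
        rw [Finset.card_eq_zero.1 (Nat.le_zero.1 (hP j hj))]
        exact Finset.disjoint_empty_left _
  | succ p ih =>
    intro I P hP hQ hd hex
    rcases I.eq_empty_or_nonempty with rfl | ⟨i, hi⟩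
    · simp
    have hcover : I ⊆ (I.filter fun j => Disjoint (P j) (Q i)) ∪
        (Q i).biUnion fun x => I.filter fun j => x ∈ P j := by
      intro j hj
      by_cases h : Disjoint (P j) (Q i)
      · simp [hj, h]
      · obtain ⟨x, hx, hx'⟩ := Finset.not_disjoint_iff.1 h
        simp only [Finset.mem_union, Finset.mem_biUnion, Finset.mem_filter]
        exact .inr ⟨x, hx', hj, hx⟩
    have hpart : ∀ x ∈ Q i, (I.filter fun j => x ∈ P j).card ≤ d * (q + 1) ^ p := by
      intro x _
      refine ih _ (fun j => (P j).erase x) ?_ ?_ ?_ ?_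
      · intro j hj
        obtain ⟨hj, hx⟩ := Finset.mem_filter.1 hj
        rw [Finset.card_erase_of_mem hx]
        have := hP j hj
        omega
      · exact fun j hj => hQ j (Finset.mem_filter.1 hj).1
      · exact fun j hj => (hd j (Finset.mem_filter.1 hj).1).mono_left (Finset.erase_subset _ _)
      · intro j hj
        obtain ⟨hj, hx⟩ := Finset.mem_filter.1 hj
        refine le_trans (Finset.card_le_card fun l hl => ?_) (hex j hj)
        simp only [Finset.mem_filter] at hl ⊢
        refine ⟨hl.1.1, ?_⟩
        have hxQ : x ∉ Q j := Finset.disjoint_left.1 (hd j hj) hx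
        rw [Finset.disjoint_left] at hl ⊢
        intro y hy hyQ
        refine hl.2 (Finset.mem_erase.2 ⟨?_, hy⟩) hyQ
        rintro rfl
        exact hxQ hyQ
    calc I.card ≤ d + (Q i).card * (d * (q + 1) ^ p) :=
          (Finset.card_le_card hcover).trans ((Finset.card_union_le _ _).trans
            (add_le_add (hex i hi) (Finset.card_biUnion_le_card_mul _ _ _ hpart)))
      _ ≤ d * (q + 1) ^ p + q * (d * (q + 1) ^ p) :=
          add_le_add (Nat.le_mul_of_pos_right _ (by positivity))
            (Nat.mul_le_mul_right _ (hQ i hi))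
      _ = d * (q + 1) ^ (p + 1) := by ring

/-- If every index is compatible with few indices, where incompatible indices are joined in one of
two clique-free graphs, then there are few indices. -/
theorem card_le_of_two_cliqueFree {ι V : Type*} [DecidableEq V] {G : SimpleGraph V}
    [DecidableRel G.Adj] {m : ℕ}
    (f g : ι → V) (s t : ℕ) :
    ∀ J : Finset ι,
      (∀ i ∈ J, (J.filter fun j => ¬ G.Adj (f i) (f j) ∧ ¬ G.Adj (g i) (g j)).card ≤ m) →
      (∀ Q ⊆ J.image f, ¬ G.IsNClique s Q) → (∀ Q ⊆ J.image g, ¬ G.IsNClique t Q) →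
      J.card + m ≤ m * 2 ^ (s + t) := by
  classical
  have key : ∀ (h : ι → V) (a : ℕ) (J : Finset ι) (i : ι), i ∈ J →
      (∀ Q ⊆ J.image h, ¬ G.IsNClique (a + 1) Q) →
      ∀ Q ⊆ (J.filter fun j => G.Adj (h i) (h j)).image h, ¬ G.IsNClique a Q := by
    intro h a J i hi hJ Q hQ hclique
    refine hJ (insert (h i) Q) ?_ (hclique.insert fun q hq => ?_)
    · refine Finset.insert_subset (Finset.mem_image_of_mem _ hi) (hQ.trans ?_)
      exact Finset.image_subset_image (Finset.filter_subset _ _)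
    · obtain ⟨j, hj, rfl⟩ := Finset.mem_image.1 (hQ hq)
      exact (Finset.mem_filter.1 hj).2
  have hsub : ∀ (J J' : Finset ι), J' ⊆ J →
      (∀ i ∈ J, (J.filter fun j => ¬ G.Adj (f i) (f j) ∧ ¬ G.Adj (g i) (g j)).card ≤ m) →
      ∀ i ∈ J', (J'.filter fun j => ¬ G.Adj (f i) (f j) ∧ ¬ G.Adj (g i) (g j)).card ≤ m :=
    fun J J' hJ h i hi =>
      (Finset.card_le_card (Finset.filter_subset_filter _ hJ)).trans (h i (hJ hi))
  induction hn : s + t generalizing s t with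
  | zero =>
    intro J _ hf _
    obtain rfl : s = 0 := by omega
    exact absurd (by simp : G.IsNClique 0 ∅) (hf ∅ (Finset.empty_subset _))
  | succ n ih =>
    intro J hJ hf hg
    rcases J.eq_empty_or_nonempty with rfl | ⟨i, hi⟩
    · simpa using Nat.le_mul_of_pos_right m (by positivity : 0 < 2 ^ (n + 1))
    rcases s with _ | s
    · exact absurd (by simp : G.IsNClique 0 ∅) (hf ∅ (Finset.empty_subset _))
    rcases t with _ | t
    · exact absurd (by simp : G.IsNClique 0 ∅) (hg ∅ (Finset.empty_subset _))
    have h1 := ih s (t + 1) (by omega) (J.filter fun j => G.Adj (f i) (f j))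
      (hsub _ _ (Finset.filter_subset _ _) hJ) (key f s J i hi hf)
      (fun Q hQ => hg Q (hQ.trans (Finset.image_subset_image (Finset.filter_subset _ _))))
    have h2 := ih (s + 1) t (by omega) (J.filter fun j => G.Adj (g i) (g j))
      (hsub _ _ (Finset.filter_subset _ _) hJ)
      (fun Q hQ => hf Q (hQ.trans (Finset.image_subset_image (Finset.filter_subset _ _))))
      (key g t J i hi hg)
    have hcover : J ⊆ (J.filter fun j => ¬ G.Adj (f i) (f j) ∧ ¬ G.Adj (g i) (g j)) ∪
        ((J.filter fun j => G.Adj (f i) (f j)) ∪ J.filter fun j => G.Adj (g i) (g j)) := by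
      intro j hj
      simp only [Finset.mem_union, Finset.mem_filter]
      tauto
    have h3 := (Finset.card_le_card hcover).trans (Finset.card_union_le _ _)
    have h4 := Finset.card_union_le (J.filter fun j => G.Adj (f i) (f j))
      (J.filter fun j => G.Adj (g i) (g j))
    have h5 := hJ i hi
    rw [pow_succ]
    linarith

section LowDegree

variable {V : Type*} [Fintype V] [DecidableEq V] {G : SimpleGraph V} [DecidableRel G.Adj] {k : ℕ}

/-- In a clique-saturated graph only boundedly many vertices of degree at most `D` have a
neighbour of degree at most `D`. -/
theorem card_low_degree_with_low_degree_neighbor (hG : Ksat (k + 2) G) (D : ℕ) :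
    (Finset.univ.filter fun v => G.degree v ≤ D ∧ ∃ u, G.Adj v u ∧ G.degree u ≤ D).card ≤
      (1 + D + D * D) * (2 ^ D + 1) ^ 2 ^ D := by
  classical
  rw [ksat_iff] at hG
  obtain ⟨hfree, hsat⟩ := hG
  have hch : ∀ v, ∃ u, (G.degree v ≤ D ∧ ∃ u, G.Adj v u ∧ G.degree u ≤ D) →
      G.Adj v u ∧ G.degree u ≤ D := by
    intro v
    by_cases h : G.degree v ≤ D ∧ ∃ u, G.Adj v u ∧ G.degree u ≤ D
    · obtain ⟨u, hu⟩ := h.2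
      exact ⟨u, fun _ => hu⟩
    · exact ⟨v, fun h' => absurd h' h⟩
  choose u hu using hch
  let P : V → Finset (Finset V) := fun v =>
    ((G.neighborFinset v).filter fun w => D < G.degree w).powerset.filter fun Q => G.IsNClique k Q
  have hcard : ∀ v, G.degree v ≤ D → (P v).card ≤ 2 ^ D := by
    intro v hv
    refine (Finset.card_filter_le _ _).trans ?_
    rw [Finset.card_powerset]
    exact Nat.pow_le_pow_right (by norm_num) ((Finset.card_filter_le _ _).trans hv)
  have hmem : ∀ v Q, Q ∈ P v ↔ (∀ q ∈ Q, G.Adj v q ∧ D < G.degree q) ∧ G.IsNClique k Q := by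
    intro v Q
    simp [P, Finset.subset_iff]
  refine card_le_of_set_pairs (fun v => P (u v)) (2 ^ D) _ P ?_ ?_ ?_ ?_
  · exact fun v hv => hcard v (Finset.mem_filter.1 hv).2.1
  · exact fun v hv => hcard _ (hu v (Finset.mem_filter.1 hv).2).2
  · intro v hv
    have := hu v (Finset.mem_filter.1 hv).2
    rw [Finset.disjoint_left]
    intro Q hQ hQ'
    rw [hmem] at hQ hQ'
    exact not_isNClique_of_adj hfree this.1 hQ.2 (fun q hq => (hQ.1 q hq).1)
      fun q hq => (hQ'.1 q hq).1
  · intro v hv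
    obtain ⟨-, hdeg⟩ := hu v (Finset.mem_filter.1 hv).2
    have hsub : (Finset.univ.filter fun v => G.degree v ≤ D ∧ ∃ u, G.Adj v u ∧ G.degree u ≤ D).filter
        (fun w => Disjoint (P w) (P (u v))) ⊆ ({u v} ∪ G.neighborFinset (u v)) ∪
          ((G.neighborFinset (u v)).filter fun y => G.degree y ≤ D).biUnion
            fun y => G.neighborFinset y := by
      intro w hw
      by_contra hn
      simp only [Finset.mem_union, Finset.mem_singleton, mem_neighborFinset, Finset.mem_biUnion,
        Finset.mem_filter, not_or, not_exists, not_and, and_imp] at hn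
      obtain ⟨Q, hQ, hadj⟩ := hsat w (u v) hn.1.1 fun h => hn.1.2 h.symm
      have hlarge : ∀ q ∈ Q, D < G.degree q := fun q hq => by
        by_contra hle
        exact hn.2 q (hadj q hq).2 (not_lt.1 hle) (hadj q hq).1.symm
      refine (Finset.not_disjoint_iff.2 ⟨Q, ?_, ?_⟩) (Finset.mem_filter.1 hw).2
      · exact (hmem _ _).2 ⟨fun q hq => ⟨(hadj q hq).1, hlarge q hq⟩, hQ⟩
      · exact (hmem _ _).2 ⟨fun q hq => ⟨(hadj q hq).2, hlarge q hq⟩, hQ⟩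
    refine (Finset.card_le_card hsub).trans ((Finset.card_union_le _ _).trans ?_)
    refine add_le_add ((Finset.card_union_le _ _).trans ?_) ?_
    · simpa using hdeg
    · refine (Finset.card_biUnion_le_card_mul _ _ D fun y hy => ?_).trans
        (Nat.mul_le_mul_right _ ((Finset.card_filter_le _ _).trans hdeg))
      exact (Finset.mem_filter.1 hy).2

end LowDegree

section LowFamily

variable {V : Type*} {G : SimpleGraph V} {k : ℕ}

theorem card_le_of_pairwise_adj {ι : Type*} (hfree : G.CliqueFree (k + 2)) (I : Finset ι)
    (p : ι → V) (h : ∀ i ∈ I, ∀ j ∈ I, i ≠ j → G.Adj (p i) (p j)) : I.card ≤ k + 1 := by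
  classical
  have hinj : Set.InjOn p I := by
    intro i hi j hj hij
    by_contra hne
    exact (h i hi j hj hne).ne hij
  rw [← Finset.card_image_of_injOn hinj]
  by_contra hlt
  refine CliqueFree.mono (by omega : k + 2 ≤ (I.image p).card) hfree _ ⟨?_, rfl⟩
  intro x hx y hy hxy
  obtain ⟨i, hi, rfl⟩ := Finset.mem_image.1 hx
  obtain ⟨j, hj, rfl⟩ := Finset.mem_image.1 hy
  exact h i hi j hj (fun he => hxy (he ▸ rfl))

/-- An independent set of vertices with distinct neighbourhoods, each of which satisfies the
saturation condition with every other vertex, in a graph without `K_{k+2}`. -/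
structure IsSatFamily (G : SimpleGraph V) (k : ℕ) (L : Finset V) : Prop where
  free : G.CliqueFree (k + 2)
  sat : ∀ v ∈ L, ∀ w, v ≠ w → ¬ G.Adj v w →
    ∃ Q : Finset V, G.IsNClique k Q ∧ ∀ q ∈ Q, G.Adj v q ∧ G.Adj w q
  indep : ∀ v ∈ L, ∀ w ∈ L, ¬ G.Adj v w
  twin : ∀ v ∈ L, ∀ w ∈ L, (∀ x, G.Adj v x ↔ G.Adj w x) → v = w

namespace IsSatFamily

variable {L : Finset V}

theorem mono {L' : Finset V} (h : IsSatFamily G k L) (hL : L' ⊆ L) : IsSatFamily G k L' where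
  free := h.free
  sat v hv := h.sat v (hL hv)
  indep v hv w hw := h.indep v (hL hv) w (hL hw)
  twin v hv w hw := h.twin v (hL hv) w (hL hw)

theorem exists_clique_adj (h : IsSatFamily G k L) {v w p : V} (hv : v ∈ L) (hw : w ∈ L)
    (hwp : G.Adj w p) (hvp : ¬ G.Adj v p) :
    ∃ Q : Finset V, G.IsNClique k Q ∧ (∀ q ∈ Q, G.Adj v q ∧ G.Adj p q) ∧
      ∃ q ∈ Q, ¬ G.Adj w q := by
  classical
  have hne : v ≠ p := by
    rintro rfl
    exact h.indep w hw v hv hwp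
  obtain ⟨Q, hQ, hadj⟩ := h.sat v hv p hne hvp
  refine ⟨Q, hQ, hadj, ?_⟩
  by_contra! hcon
  exact not_isNClique_of_adj h.free hwp hQ hcon fun q hq => (hadj q hq).2

theorem exists_adj (h : IsSatFamily G k L) {v w p : V} (hv : v ∈ L) (hw : w ∈ L)
    (hwp : G.Adj w p) (hvp : ¬ G.Adj v p) : ∃ q, G.Adj v q ∧ ¬ G.Adj w q ∧ G.Adj p q := by
  obtain ⟨Q, -, hadj, q, hq, hwq⟩ := h.exists_clique_adj hv hw hwp hvp
  exact ⟨q, (hadj q hq).1, hwq, (hadj q hq).2⟩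

theorem exists_mem_diff (h : IsSatFamily G k L) {v w : V} (hv : v ∈ L) (hw : w ∈ L) (hne : v ≠ w) :
    ∃ p, G.Adj w p ∧ ¬ G.Adj v p := by
  by_contra! hcon
  have : ∃ p, G.Adj v p ∧ ¬ G.Adj w p := by
    by_contra! hcon'
    exact hne (h.twin v hv w hw fun x => ⟨hcon' x, hcon x⟩)
  obtain ⟨p, hvp, hwp⟩ := this
  obtain ⟨q, hwq, hvq, -⟩ := h.exists_adj hw hv hvp hwp
  exact hvq (hcon q hwq)

/-- Boundedly many neighbourhoods contain a given set and at most one further vertex. -/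
theorem card_le_of_one_extra (h : IsSatFamily G k L) (Z : Finset V)
    (hZ : ∀ v ∈ L, ∀ z ∈ Z, G.Adj v z) (hp : ∀ v ∈ L, ∃ p, ∀ x, G.Adj v x → x ∈ Z ∨ x = p) :
    L.card ≤ k + 1 := by
  have hch : ∀ v, ∃ p, v ∈ L → ∀ x, G.Adj v x → x ∈ Z ∨ x = p := by
    intro v
    by_cases hv : v ∈ L
    · obtain ⟨p, hp⟩ := hp v hv
      exact ⟨p, fun _ => hp⟩
    · exact ⟨v, fun h' => absurd h' hv⟩
  choose p hp using hch
  refine card_le_of_pairwise_adj h.free _ p fun v hv w hw hne => ?_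
  obtain ⟨x, hwx, hvx⟩ := h.exists_mem_diff hv hw hne
  obtain ⟨y, hvy, hwy, hxy⟩ := h.exists_adj hv hw hwx hvx
  have hx := (hp w hw x hwx).resolve_left fun hz => hvx (hZ v hv x hz)
  have hy := (hp v hv y hvy).resolve_left fun hz => hwy (hZ w hw y hz)
  rw [← hx, ← hy]
  exact hxy.symm

end IsSatFamily

/-- A saturated family whose members are joined to a common `k`-clique `K` and to three further
vertices `e v 0`, `e v 1`, `e v 2`, with a common adjacency pattern. -/
structure IsTripleFamily (G : SimpleGraph V) [DecidableRel G.Adj] (k : ℕ) (K L : Finset V)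
    (e : V → Fin 3 → V) (M : Fin 3 → Finset V) : Prop extends IsSatFamily G k L where
  clique : G.IsNClique k K
  adj_iff : ∀ v ∈ L, ∀ x, G.Adj v x ↔ x ∈ K ∨ ∃ i, x = e v i
  inj : ∀ v ∈ L, Function.Injective (e v)
  notMem : ∀ v ∈ L, ∀ i, e v i ∉ K
  miss : ∀ v ∈ L, ∀ i, M i = K.filter fun x => ¬ G.Adj (e v i) x
  pattern : ∀ v ∈ L, ∀ w ∈ L, ∀ i j, G.Adj (e v i) (e v j) → G.Adj (e w i) (e w j)

namespace IsTripleFamily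

variable [DecidableRel G.Adj] {K L : Finset V} {e : V → Fin 3 → V} {M : Fin 3 → Finset V}

theorem adj_of_notMem_miss (h : IsTripleFamily G k K L e M) {v : V} (hv : v ∈ L) {i : Fin 3}
    {x : V} (hx : x ∈ K) (hM : x ∉ M i) : G.Adj (e v i) x := by
  by_contra hn
  exact hM (by rw [h.miss v hv i]; simp [hx, hn])

theorem notMem_miss (h : IsTripleFamily G k K L e M) {v : V} (hv : v ∈ L) {i : Fin 3}
    {x : V} (hadj : G.Adj (e v i) x) : x ∉ M i := by
  rw [h.miss v hv i]
  simp [hadj]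

variable [DecidableEq V]

theorem card_clique_le (h : IsTripleFamily G k K L e M) (Y X : Finset V) (hY : G.IsClique Y)
    (hYK : Disjoint Y K) (hadj : ∀ y ∈ Y, ∀ x ∈ K, x ∉ X → G.Adj y x) :
    Y.card ≤ X.card + 1 := by
  by_contra hlt
  have hc : (Y ∪ (K \ X)).card = Y.card + (K \ X).card :=
    Finset.card_union_of_disjoint (hYK.mono_right Finset.sdiff_subset)
  have h1 := Finset.le_card_sdiff X K
  have h2 := h.clique.2
  refine CliqueFree.mono (by omega : k + 2 ≤ (Y ∪ (K \ X)).card) h.free _ ⟨?_, rfl⟩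
  intro x hx y hy hxy
  simp only [Finset.coe_union, Finset.coe_sdiff, Set.mem_union, Finset.mem_coe,
    Set.mem_sdiff] at hx hy
  rcases hx with hx | hx <;> rcases hy with hy | hy
  · exact hY hx hy hxy
  · exact hadj x hx y hy.1 hy.2
  · exact (hadj y hy x hx.1 hx.2).symm
  · exact h.clique.1 hx.1 hy.1 hxy

theorem card_le_card_miss (h : IsTripleFamily G k K L e M) {v : V} (hv : v ∈ L)
    (T : Finset (Fin 3)) (hT : ∀ i ∈ T, ∀ j ∈ T, i ≠ j → G.Adj (e v i) (e v j)) :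
    T.card ≤ (T.biUnion M).card := by
  have hadj : ∀ i, G.Adj v (e v i) := fun i => (h.adj_iff v hv _).2 (.inr ⟨i, rfl⟩)
  have hK : ∀ x ∈ K, G.Adj v x := fun x hx => (h.adj_iff v hv _).2 (.inl hx)
  have := h.card_clique_le (insert v (T.image (e v))) (T.biUnion M) ?_ ?_ ?_
  · rw [Finset.card_insert_of_notMem, Finset.card_image_of_injective _ (h.inj v hv)] at this
    · omega
    · intro hmem
      obtain ⟨i, -, hi⟩ := Finset.mem_image.1 hmem
      exact (hadj i).ne hi.symm
  · rw [Finset.coe_insert, isClique_insert]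
    refine ⟨?_, ?_⟩
    · intro x hx y hy hxy
      obtain ⟨i, hi, rfl⟩ := Finset.mem_image.1 hx
      obtain ⟨j, hj, rfl⟩ := Finset.mem_image.1 hy
      exact hT i hi j hj fun hij => hxy (hij ▸ rfl)
    · intro x hx _
      obtain ⟨i, -, rfl⟩ := Finset.mem_image.1 hx
      exact hadj i
  · rw [Finset.disjoint_left]
    intro x hx hxK
    rcases Finset.mem_insert.1 hx with rfl | hx
    · exact (hK x hxK).ne rfl
    · obtain ⟨i, -, rfl⟩ := Finset.mem_image.1 hx
      exact h.notMem v hv i hxK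
  · intro y hy x hx hX
    rcases Finset.mem_insert.1 hy with rfl | hy
    · exact hK x hx
    · obtain ⟨i, hi, rfl⟩ := Finset.mem_image.1 hy
      exact h.adj_of_notMem_miss hv hx fun hm => hX (Finset.mem_biUnion.2 ⟨i, hi, hm⟩)

/-- The vertex `v` has many partners in its star at position `i`. -/
def Rich (G : SimpleGraph V) [DecidableRel G.Adj] (k : ℕ) (L : Finset V) (e : V → Fin 3 → V)
    (i : Fin 3) (v : V) : Prop :=
  6 * (k + 1) < (L.filter fun w => e w i = e v i ∧ ∀ j, j ≠ i → ¬ G.Adj (e v j) (e w j)).card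

theorem card_through_pair (h : IsTripleFamily G k K L e M) {x y : V} (hxy : x ≠ y) (hx : x ∉ K)
    (hy : y ∉ K) : (L.filter fun w => G.Adj w x ∧ G.Adj w y).card ≤ k + 1 := by
  refine (h.mono (Finset.filter_subset _ _)).card_le_of_one_extra (insert x (insert y K)) ?_ ?_
  all_goals
    intro w hw
    obtain ⟨hwL, hwx, hwy⟩ := Finset.mem_filter.1 hw
  · intro z hz
    simp only [Finset.mem_insert] at hz
    rcases hz with rfl | rfl | hz
    · exact hwx
    · exact hwy
    · exact (h.adj_iff w hwL z).2 (.inl hz)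
  · obtain ⟨i, rfl⟩ := ((h.adj_iff w hwL x).1 hwx).resolve_left hx
    obtain ⟨j, rfl⟩ := ((h.adj_iff w hwL y).1 hwy).resolve_left hy
    have hij : i ≠ j := fun hij => hxy (hij ▸ rfl)
    have hthird : ∀ i j : Fin 3, i ≠ j → ∃ l, ∀ m, m = i ∨ m = j ∨ m = l := by decide
    obtain ⟨l, hl⟩ := hthird i j hij
    refine ⟨e w l, fun z hz => ?_⟩
    rcases (h.adj_iff w hwL z).1 hz with hz | ⟨m, rfl⟩
    · simp [hz]
    · rcases hl m with rfl | rfl | rfl <;> simp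

theorem exists_partner (h : IsTripleFamily G k K L e M) {v : V} (hv : v ∈ L) {i : Fin 3}
    (hrich : Rich G k L e i v) (Y : Finset V) (hY : Y.card ≤ 6) (hYK : Disjoint Y K)
    (hiY : e v i ∉ Y) :
    ∃ w ∈ L, e w i = e v i ∧ (∀ j, j ≠ i → ¬ G.Adj (e v j) (e w j)) ∧ ∀ j, e w j ∉ Y := by
  by_contra! hcon
  refine absurd hrich (not_lt.2 ?_)
  have hsub : (L.filter fun w => e w i = e v i ∧ ∀ j, j ≠ i → ¬ G.Adj (e v j) (e w j)) ⊆
      Y.biUnion fun y => L.filter fun w => G.Adj w (e v i) ∧ G.Adj w y := by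
    intro w hw
    obtain ⟨hwL, hwi, hw⟩ := Finset.mem_filter.1 hw
    obtain ⟨j, hj⟩ := hcon w hwL hwi hw
    refine Finset.mem_biUnion.2 ⟨_, hj, Finset.mem_filter.2 ⟨hwL, ?_, ?_⟩⟩
    · exact (h.adj_iff w hwL _).2 (.inr ⟨i, hwi.symm⟩)
    · exact (h.adj_iff w hwL _).2 (.inr ⟨j, rfl⟩)
  refine (Finset.card_le_card hsub).trans ((Finset.card_biUnion_le_card_mul _ _ (k + 1) ?_).trans
    (Nat.mul_le_mul_right _ hY))
  intro y hy
  refine h.card_through_pair ?_ (h.notMem v hv i) (Finset.disjoint_left.1 hYK hy)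
  rintro rfl
  exact hiY hy

theorem adj_and_tight (h : IsTripleFamily G k K L e M) {v w : V} (hv : v ∈ L) (hw : w ∈ L)
    {i j l : Fin 3} (hijl : ∀ m, m = i ∨ m = j ∨ m = l) (hi : e w i = e v i)
    (hjj : ¬ G.Adj (e v j) (e w j)) (hnot : ¬ G.Adj v (e w j)) :
    G.Adj (e w j) (e v l) ∧ ((M j ∪ M l).card ≤ 1 ∨
      ((M i ∪ (M j ∪ M l)).card ≤ 2 ∧ G.Adj (e v i) (e v l) ∧ G.Adj (e v i) (e v j))) := by
  obtain ⟨Q, hQ, hadj, q, hqQ, hwq⟩ := h.exists_clique_adj hv hw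
    ((h.adj_iff w hw _).2 (.inr ⟨j, rfl⟩)) hnot
  have hq : q = e v l := by
    rcases (h.adj_iff v hv q).1 (hadj q hqQ).1 with hK | ⟨m, rfl⟩
    · exact absurd ((h.adj_iff w hw q).2 (.inl hK)) hwq
    · rcases hijl m with rfl | rfl | rfl
      · exact absurd ((h.adj_iff w hw _).2 (.inr ⟨_, hi.symm⟩)) hwq
      · exact absurd (hadj _ hqQ).2.symm hjj
      · rfl
  subst hq
  refine ⟨(hadj _ hqQ).2, ?_⟩
  have hMK : ∀ m, M m ⊆ K := fun m => by
    rw [h.miss v hv m]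
    exact Finset.filter_subset _ _
  have hmem : ∀ x ∈ Q, x = e v i ∨ x = e v l ∨ x ∈ K \ (M j ∪ M l) := by
    intro x hx
    rcases (h.adj_iff v hv x).1 (hadj x hx).1 with hK | ⟨m, rfl⟩
    · have hl : x ∉ M l := by
        refine h.notMem_miss hv (hQ.1 hqQ hx ?_)
        rintro rfl
        exact h.notMem v hv _ hK
      have hj : x ∉ M j := h.notMem_miss hw (hadj x hx).2
      simp [hK, hl, hj]
    · rcases hijl m with rfl | rfl | rfl
      · exact .inl rfl
      · exact absurd (hadj _ hx).2.symm hjj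
      · exact .inr (.inl rfl)
  have hk := h.clique.2
  have hQk := hQ.2
  by_cases hiQ : e v i ∈ Q
  · by_cases hil : e v i = e v l
    · have hsub : Q ⊆ insert (e v l) (K \ (M j ∪ M l)) := by
        intro x hx
        rcases hmem x hx with rfl | rfl | hx <;> simp_all
      have h1 := (Finset.card_le_card hsub).trans (Finset.card_insert_le _ _)
      have h2 := Finset.card_sdiff_add_card_eq_card (Finset.union_subset (hMK j) (hMK l))
      left
      omega
    · right
      refine ⟨?_, hQ.1 hiQ hqQ hil, ?_⟩
      · have hsub : Q ⊆ insert (e v i) (insert (e v l) (K \ (M i ∪ (M j ∪ M l)))) := by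
          intro x hx
          by_cases hxi : x = e v i
          · simp [hxi]
          rcases hmem x hx with rfl | rfl | hx'
          · simp
          · simp
          · have : x ∉ M i := h.notMem_miss hv (hQ.1 hiQ hx (Ne.symm hxi))
            simp_all
        have h1 := (Finset.card_le_card hsub).trans (Finset.card_insert_le _ _)
        have h1' := Finset.card_insert_le (e v l) (K \ (M i ∪ (M j ∪ M l)))
        have h2 := Finset.card_sdiff_add_card_eq_card
          (Finset.union_subset (hMK i) (Finset.union_subset (hMK j) (hMK l)))
        omega
      · refine h.pattern w hw v hv i j ?_
        rw [hi]
        exact (hadj _ hiQ).2.symm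
  · left
    have hsub : Q ⊆ insert (e v l) (K \ (M j ∪ M l)) := by
      intro x hx
      rcases hmem x hx with rfl | rfl | hx'
      · exact absurd hx hiQ
      · simp
      · exact Finset.mem_insert_of_mem hx'
    have h1 := (Finset.card_le_card hsub).trans (Finset.card_insert_le _ _)
    have h2 := Finset.card_sdiff_add_card_eq_card (Finset.union_subset (hMK j) (hMK l))
    omega

/-- A partner at position `i`, avoiding a given small set. -/
theorem exists_partner_avoiding (h : IsTripleFamily G k K L e M) {v : V} (hv : v ∈ L)
    {i j l : Fin 3} (hij : i ≠ j) (hil : i ≠ l) (hijl : ∀ m, m = i ∨ m = j ∨ m = l)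
    (hrich : Rich G k L e i v) (Y : Finset V) (hY : Y.card ≤ 4) (hYK : Disjoint Y K)
    (hiY : e v i ∉ Y) :
    ∃ w ∈ L, e w i = e v i ∧ (∀ m, m ≠ i → ¬ G.Adj (e v m) (e w m)) ∧
      (∀ m, e w m ∉ Y) ∧ ∀ m, m ≠ i → ¬ G.Adj v (e w m) := by
  obtain ⟨w, hw, hwi, hgood, hav⟩ := h.exists_partner hv hrich (insert (e v j) (insert (e v l) Y))
    ((Finset.card_insert_le _ _).trans (by
      have := Finset.card_insert_le (e v l) Y
      omega))
    (by simp [h.notMem v hv, hYK])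
    (by simp [hiY, (h.inj v hv).eq_iff, hij, hil])
  refine ⟨w, hw, hwi, hgood, fun m hm => hav m (by simp [hm]), fun m hm hadj => ?_⟩
  rcases (h.adj_iff v hv _).1 hadj with hK | ⟨m', hm'⟩
  · exact h.notMem w hw m hK
  · rcases hijl m' with rfl | rfl | rfl
    · exact hm (h.inj w hw (hm'.trans hwi.symm))
    · exact hav m (by simp [hm'])
    · exact hav m (by simp [hm'])

theorem card_miss_union_le_one (h : IsTripleFamily G k K L e M) {v : V} (hv : v ∈ L)
    (hrich : ∀ i, Rich G k L e i v) {i j l : Fin 3} (hij : i ≠ j) (hil : i ≠ l) (hjl : j ≠ l)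
    (hijl : ∀ m, m = i ∨ m = j ∨ m = l) : (M j ∪ M l).card ≤ 1 := by
  obtain ⟨w, hw, hwi, hgood, -, hnot⟩ := h.exists_partner_avoiding hv hij hil hijl (hrich i) ∅
    (by simp) (by simp) (by simp)
  obtain ⟨-, h1 | ⟨hc, h1, h2⟩⟩ := h.adj_and_tight hv hw hijl hwi (hgood j hij.symm)
    (hnot j hij.symm)
  · exact h1
  exfalso
  obtain ⟨w, hw, hwl, hgood, -, hnot⟩ := h.exists_partner_avoiding (i := l) (j := j) (l := i) hv
    hjl.symm hil.symm (fun m => by rcases hijl m with h | h | h <;> simp [h]) (hrich l) ∅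
    (by simp) (by simp) (by simp)
  obtain ⟨-, h3 | ⟨-, -, h4⟩⟩ := h.adj_and_tight (i := l) (j := j) (l := i) hv hw
    (fun m => by rcases hijl m with h | h | h <;> simp [h]) hwl (hgood j hjl) (hnot j hjl)
  · have := h.card_le_card_miss hv {j, i} (by simp [h2, h2.symm])
    rw [Finset.card_pair hij.symm] at this
    simp at this
    omega
  · have := h.card_le_card_miss hv {i, j, l} (by simp [h1, h2, h1.symm, h2.symm, h4, h4.symm])
    rw [Finset.card_eq_three.2 ⟨i, j, l, hij, hil, hjl, rfl⟩] at this
    simp at this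
    omega

theorem not_forall_rich (h : IsTripleFamily G k K L e M) {v : V} (hv : v ∈ L) :
    ¬ ∀ i, Rich G k L e i v := by
  intro hrich
  have h01 := h.card_miss_union_le_one hv hrich (i := 2) (j := 0) (l := 1) (by decide) (by decide)
    (by decide) (by decide)
  have h02 := h.card_miss_union_le_one hv hrich (i := 1) (j := 0) (l := 2) (by decide) (by decide)
    (by decide) (by decide)
  have h0 : 1 ≤ (M 0).card := by simpa using h.card_le_card_miss hv {0} (by simp)
  have hsub : ∀ i, M i ⊆ M 0 := by
    have h1 := Finset.eq_of_subset_of_card_le (s := M 0) (t := M 0 ∪ M 1)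
      Finset.subset_union_left (h01.trans h0)
    have h2 := Finset.eq_of_subset_of_card_le (s := M 0) (t := M 0 ∪ M 2)
      Finset.subset_union_left (h02.trans h0)
    intro i
    fin_cases i
    · exact subset_rfl
    · exact Finset.union_eq_left.1 h1.symm
    · exact Finset.union_eq_left.1 h2.symm
  have hcard : (M 0).card ≤ 1 := (Finset.card_le_card Finset.subset_union_left).trans h01
  have htri : ∀ x ∈ L, ∀ y ∈ L, ∀ z ∈ L, ∀ i j l, G.Adj (e x i) (e y j) →
      G.Adj (e x i) (e z l) → G.Adj (e y j) (e z l) → False := by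
    intro x hx y hy z hz i j l h1 h2 h3
    have := h.card_clique_le {e x i, e y j, e z l} (M 0)
      (is3Clique_triple_iff.2 ⟨h1, h2, h3⟩).1 ?_ ?_
    · rw [Finset.card_eq_three.2 ⟨_, _, _, h1.ne, h2.ne, h3.ne, rfl⟩] at this
      omega
    · simp [h.notMem x hx, h.notMem y hy, h.notMem z hz]
    · intro u hu p hp hpM
      simp only [Finset.mem_insert, Finset.mem_singleton] at hu
      rcases hu with rfl | rfl | rfl
      · exact h.adj_of_notMem_miss hx hp fun hm => hpM (hsub _ hm)
      · exact h.adj_of_notMem_miss hy hp fun hm => hpM (hsub _ hm)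
      · exact h.adj_of_notMem_miss hz hp fun hm => hpM (hsub _ hm)
  obtain ⟨x, hx, hxi, hxg, -, hxn⟩ := h.exists_partner_avoiding (i := 0) (j := 1) (l := 2) hv
    (by decide) (by decide) (by decide) (hrich 0) ∅ (by simp) (by simp) (by simp)
  obtain ⟨y, hy, hyi, hyg, hyY, hyn⟩ := h.exists_partner_avoiding (i := 1) (j := 0) (l := 2) hv
    (by decide) (by decide) (by decide) (hrich 1) {e x 1, e x 2}
    (Finset.card_le_two.trans (by norm_num)) (by simp [h.notMem x hx])
    (by
      have h1 := hxn 1 (by decide)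
      have h2 := hxn 2 (by decide)
      simp only [h.adj_iff v hv, not_or, not_exists] at h1 h2
      simp [Ne.symm (h1.2 1), Ne.symm (h2.2 1)])
  obtain ⟨z, hz, hzi, hzg, hzY, hzn⟩ := h.exists_partner_avoiding (i := 2) (j := 0) (l := 1) hv
    (by decide) (by decide) (by decide) (hrich 2) {e x 1, e x 2, e y 0, e y 2}
    Finset.card_le_four (by simp [h.notMem x hx, h.notMem y hy])
    (by
      have h1 := hxn 1 (by decide)
      have h2 := hxn 2 (by decide)
      have h3 := hyn 0 (by decide)
      have h4 := hyn 2 (by decide)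
      simp only [h.adj_iff v hv, not_or, not_exists] at h1 h2 h3 h4
      simp [Ne.symm (h1.2 2), Ne.symm (h2.2 2), Ne.symm (h3.2 2), Ne.symm (h4.2 2)])
  have adj_x1 := (h.adj_and_tight (i := 0) (j := 1) (l := 2) hv hx (by decide) hxi
    (hxg 1 (by decide)) (hxn 1 (by decide))).1
  have adj_x2 := (h.adj_and_tight (i := 0) (j := 2) (l := 1) hv hx (by decide) hxi
    (hxg 2 (by decide)) (hxn 2 (by decide))).1
  have adj_y0 := (h.adj_and_tight (i := 1) (j := 0) (l := 2) hv hy (by decide) hyi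
    (hyg 0 (by decide)) (hyn 0 (by decide))).1
  have adj_y2 := (h.adj_and_tight (i := 1) (j := 2) (l := 0) hv hy (by decide) hyi
    (hyg 2 (by decide)) (hyn 2 (by decide))).1
  have adj_z0 := (h.adj_and_tight (i := 2) (j := 0) (l := 1) hv hz (by decide) hzi
    (hzg 0 (by decide)) (hzn 0 (by decide))).1
  have adj_z1 := (h.adj_and_tight (i := 2) (j := 1) (l := 0) hv hz (by decide) hzi
    (hzg 1 (by decide)) (hzn 1 (by decide))).1
  have hcross : ∀ u ∈ L, ∀ w ∈ L, ∀ i, (∀ j, e u i ≠ e w j) →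
      ∃ j, G.Adj (e u i) (e w j) := by
    intro u hu w hw i hne
    obtain ⟨q, hwq, huq, hadj⟩ := h.exists_adj hw hu ((h.adj_iff u hu _).2 (.inr ⟨i, rfl⟩))
      (fun hadj => ((h.adj_iff w hw _).1 hadj).elim (h.notMem u hu i) fun ⟨j, hj⟩ => hne j hj)
    rcases (h.adj_iff w hw q).1 hwq with hK | ⟨j, rfl⟩
    · exact absurd ((h.adj_iff u hu q).2 (.inl hK)) huq
    · exact ⟨j, hadj⟩
  have hyz : G.Adj (e y 2) (e z 0) := by
    obtain ⟨j, hj⟩ := hcross y hy z hz 2 fun j hj => hzY j (by simp [← hj])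
    fin_cases j
    · exact hj
    · exact (htri y hy z hz v hv 2 1 0 hj adj_y2 adj_z1).elim
    · exact absurd (by simpa [hzi] using hj.symm) (hyg 2 (by decide))
  have hxy : G.Adj (e x 1) (e y 2) := by
    obtain ⟨j, hj⟩ := hcross x hx y hy 1 fun j hj => hyY j (by simp [← hj])
    fin_cases j
    · exact (htri x hx y hy v hv 1 0 2 hj adj_x1 adj_y0).elim
    · exact absurd (by simpa [hyi] using hj.symm) (hxg 1 (by decide))
    · exact hj
  have hzx : G.Adj (e z 0) (e x 1) := by
    obtain ⟨j, hj⟩ := hcross z hz x hx 0 fun j hj => by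
      fin_cases j
      · have h1 := hzn 0 (by decide)
        simp only [h.adj_iff v hv, not_or, not_exists] at h1
        exact h1.2 0 (hj.trans hxi)
      · exact hzY 0 (by simp [hj])
      · exact hzY 0 (by simp [hj])
    fin_cases j
    · exact absurd (by simpa [hxi] using hj.symm) (hzg 0 (by decide))
    · exact hj
    · exact (htri z hz x hx v hv 0 2 1 hj adj_z0 adj_x2).elim
  exact htri x hx y hy z hz 1 2 0 hxy hzx.symm hyz

end IsTripleFamily

theorem IsTripleFamily.card_le [DecidableEq V] [DecidableRel G.Adj] {K L : Finset V}
    {e : V → Fin 3 → V} {M : Fin 3 → Finset V} (h : IsTripleFamily G k K L e M) (A : Finset V)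
    (hA : ∀ v ∈ L, ∀ i, e v i ∈ A) :
    L.card ≤ 3 * (A.card * (6 * (k + 1) * 2 ^ (k + 2 + (k + 2)))) := by
  classical
  have hcover : L ⊆ (Finset.univ : Finset (Fin 3)).biUnion fun i => A.biUnion fun x =>
      L.filter fun v => e v i = x ∧ ¬ Rich G k L e i v := by
    intro v hv
    have := h.not_forall_rich hv
    push Not at this
    obtain ⟨i, hi⟩ := this
    simp only [Finset.mem_biUnion, Finset.mem_univ, true_and, Finset.mem_filter]
    exact ⟨i, e v i, hA v hv i, hv, rfl, hi⟩
  refine (Finset.card_le_card hcover).trans ?_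
  refine (Finset.card_biUnion_le_card_mul _ _ _ fun i _ => ?_).trans
    (by rw [Finset.card_univ, Fintype.card_fin])
  refine Finset.card_biUnion_le_card_mul _ _ _ fun x _ => ?_
  have hothers : ∀ i : Fin 3, ∃ j l, ∀ m, m ≠ i → m = j ∨ m = l := by decide
  obtain ⟨j, l, hjl⟩ := hothers i
  have hclique : ∀ Q, ¬ G.IsNClique (k + 2) Q := h.free
  refine (Nat.le_add_right _ _).trans (card_le_of_two_cliqueFree (G := G) (fun v => e v j)
    (fun v => e v l) (k + 2) (k + 2) _ ?_ (fun Q _ => hclique Q) fun Q _ => hclique Q)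
  intro v hv
  obtain ⟨hvL, rfl, hrich⟩ := Finset.mem_filter.1 hv
  refine le_trans (Finset.card_le_card fun w hw => ?_) (not_lt.1 hrich)
  simp only [Finset.mem_filter] at hw ⊢
  refine ⟨hw.1.1, hw.1.2.1, fun m hm => ?_⟩
  rcases hjl m hm with rfl | rfl
  · exact hw.2.1
  · exact hw.2.2

namespace IsSatFamily

variable [Fintype V] [DecidableEq V] [DecidableRel G.Adj] {L : Finset V}

theorem card_le_of_clique_of_three_extra (h : IsSatFamily G k L) {K A : Finset V}
    (hK : G.IsNClique k K) (hKL : ∀ v ∈ L, K ⊆ G.neighborFinset v)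
    (hA : ∀ v ∈ L, G.neighborFinset v ⊆ A) (h3 : ∀ v ∈ L, (G.neighborFinset v \ K).card = 3) :
    L.card ≤ 3 * (A.card * (6 * (k + 1) * 2 ^ (k + 2 + (k + 2)))) * ((2 ^ k) ^ 3 * 2 ^ 9) := by
  have hch : ∀ v, ∃ e : Fin 3 → V, v ∈ L → Function.Injective e ∧
      ∀ x, x ∈ G.neighborFinset v \ K ↔ ∃ i, x = e i := by
    intro v
    by_cases hv : v ∈ L
    · let f := Finset.equivFinOfCardEq (h3 v hv)
      refine ⟨fun i => (f.symm i : V), fun _ => ⟨?_, fun x => ⟨fun hx => ?_, ?_⟩⟩⟩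
      · exact Subtype.val_injective.comp f.symm.injective
      · exact ⟨f ⟨x, hx⟩, by simp⟩
      · rintro ⟨i, rfl⟩
        exact (f.symm i).2
    · exact ⟨fun _ => v, fun h' => absurd h' hv⟩
  choose e he using hch
  have hmem : ∀ v ∈ L, ∀ i, e v i ∈ G.neighborFinset v \ K := fun v hv i =>
    ((he v hv).2 _).2 ⟨i, rfl⟩
  let κ : V → (Fin 3 → Finset V) × (Fin 3 → Fin 3 → Bool) := fun v =>
    (fun i => K.filter fun x => ¬ G.Adj (e v i) x, fun i j => decide (G.Adj (e v i) (e v j)))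
  have himage : (L.image κ).card ≤ (2 ^ k) ^ 3 * 2 ^ 9 := by
    have hsub : L.image κ ⊆ Fintype.piFinset (fun _ : Fin 3 => K.powerset) ×ˢ Finset.univ := by
      intro y hy
      obtain ⟨v, -, rfl⟩ := Finset.mem_image.1 hy
      simp [κ, Finset.filter_subset]
    refine (Finset.card_le_card hsub).trans ?_
    rw [Finset.card_product, Fintype.card_piFinset_const, Finset.card_powerset, hK.2,
      Finset.card_univ]
    simp
  refine (Finset.card_le_mul_card_image L _ fun y _ => ?_).trans (Nat.mul_le_mul_left _ himage)
  have htriple : IsTripleFamily G k K (L.filter fun v => κ v = y) e y.1 :=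
    { h.mono (Finset.filter_subset _ _) with
      clique := hK
      adj_iff := by
        intro v hv x
        have hv := (Finset.mem_filter.1 hv).1
        rw [← (he v hv).2 x, Finset.mem_sdiff, mem_neighborFinset]
        have : x ∈ K → G.Adj v x := fun hx => by simpa using hKL v hv hx
        tauto
      inj := fun v hv => (he v (Finset.mem_filter.1 hv).1).1
      notMem := fun v hv i => (Finset.mem_sdiff.1 (hmem v (Finset.mem_filter.1 hv).1 i)).2
      miss := by
        intro v hv i
        rw [← (Finset.mem_filter.1 hv).2]
      pattern := by
        intro v hv w hw i j hadj
        have heq : κ v = κ w := (Finset.mem_filter.1 hv).2.trans (Finset.mem_filter.1 hw).2.symm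
        have := congrFun (congrFun (congrArg Prod.snd heq) i) j
        simpa [κ, hadj] using this }
  exact htriple.card_le A fun v hv i => hA v (Finset.mem_filter.1 hv).1
    (Finset.mem_sdiff.1 (hmem v (Finset.mem_filter.1 hv).1 i)).1

theorem card_le_of_clique_of_two_extra (h : IsSatFamily G k L) {K A : Finset V}
    (hKL : ∀ v ∈ L, K ⊆ G.neighborFinset v)
    (hA : ∀ v ∈ L, G.neighborFinset v ⊆ A) (h2 : ∀ v ∈ L, (G.neighborFinset v \ K).card ≤ 2) :
    L.card ≤ (A.card + 1) * (k + 1) := by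
  have hcover : L ⊆ (A.biUnion fun p => L.filter fun v => p ∈ G.neighborFinset v \ K) ∪
      L.filter fun v => G.neighborFinset v \ K = ∅ := by
    intro v hv
    rcases (G.neighborFinset v \ K).eq_empty_or_nonempty with hempty | ⟨p, hp⟩
    · exact Finset.mem_union_right _ (Finset.mem_filter.2 ⟨hv, hempty⟩)
    · refine Finset.mem_union_left _ (Finset.mem_biUnion.2 ⟨p, ?_, Finset.mem_filter.2 ⟨hv, hp⟩⟩)
      exact hA v hv (Finset.mem_sdiff.1 hp).1
  refine (Finset.card_le_card hcover).trans ((Finset.card_union_le _ _).trans ?_)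
  rw [add_mul, one_mul]
  refine add_le_add (Finset.card_biUnion_le_card_mul _ _ _ fun p _ => ?_) ?_
  · refine (h.mono (Finset.filter_subset _ _)).card_le_of_one_extra (insert p K) ?_ ?_
    all_goals
      intro v hv
      obtain ⟨hvL, hp⟩ := Finset.mem_filter.1 hv
    · intro z hz
      rcases Finset.mem_insert.1 hz with rfl | hz
      · simpa using (Finset.mem_sdiff.1 hp).1
      · simpa using hKL v hvL hz
    · have hcard : ((G.neighborFinset v \ K).erase p).card ≤ 1 := by
        rw [Finset.card_erase_of_mem hp]
        have := h2 v hvL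
        omega
      have : Nonempty V := ⟨v⟩
      obtain ⟨q, hq⟩ := Finset.card_le_one_iff_subset_singleton.1 hcard
      refine ⟨q, fun x hx => ?_⟩
      by_cases hxZ : x ∈ insert p K
      · exact .inl hxZ
      · refine .inr (Finset.mem_singleton.1 (hq ?_))
        simp_all
  · refine (h.mono (Finset.filter_subset _ _)).card_le_of_one_extra K ?_ ?_
    all_goals
      intro v hv
      obtain ⟨hvL, hempty⟩ := Finset.mem_filter.1 hv
    · intro z hz
      simpa using hKL v hvL hz
    · refine ⟨v, fun x hx => .inl ?_⟩
      rw [Finset.sdiff_eq_empty_iff_subset] at hempty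
      exact hempty (by simpa using hx)

end IsSatFamily

/-- Vertices of degree at most `k + 3` in a saturated family are at most linearly many in terms
of the size of the union of their neighbourhoods. -/
theorem exists_card_satFamily_le (k : ℕ) : ∃ C : ℕ, ∀ (V : Type) [Fintype V] [DecidableEq V]
    (G : SimpleGraph V) [DecidableRel G.Adj] (L A : Finset V), IsSatFamily G k L →
      (∀ v ∈ L, G.neighborFinset v ⊆ A) → (∀ v ∈ L, G.degree v ≤ k + 3) →
      L.card ≤ C * (A.card + 1) := by
  set C₁ := 3 * (6 * (k + 1) * 2 ^ (k + 2 + (k + 2))) * ((2 ^ k) ^ 3 * 2 ^ 9) with hC₁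
  refine ⟨1 + 2 ^ (k + 3) * (C₁ + (k + 1)), ?_⟩
  intro V _ _ G _ L A h hA hdeg
  have hclique : ∀ K : Finset V, G.IsNClique k K →
      (L.filter fun v => K ⊆ G.neighborFinset v).card ≤ (C₁ + (k + 1)) * (A.card + 1) := by
    intro K hK
    rw [← Finset.card_filter_add_card_filter_not (fun v => (G.neighborFinset v \ K).card = 3)]
    have hsub : ∀ p : V → Prop, ∀ [DecidablePred p],
        (L.filter fun v => K ⊆ G.neighborFinset v).filter p ⊆ L := fun p _ =>
      (Finset.filter_subset _ _).trans (Finset.filter_subset _ _)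
    have h1 := (h.mono (hsub fun v => (G.neighborFinset v \ K).card = 3)
      ).card_le_of_clique_of_three_extra (A := A) hK
      (fun v hv => (Finset.mem_filter.1 (Finset.mem_filter.1 hv).1).2)
      (fun v hv => hA v (hsub _ hv)) (fun v hv => (Finset.mem_filter.1 hv).2)
    have h2 := (h.mono (hsub fun v => ¬ (G.neighborFinset v \ K).card = 3)
      ).card_le_of_clique_of_two_extra (K := K) (A := A)
      (fun v hv => (Finset.mem_filter.1 (Finset.mem_filter.1 hv).1).2)
      (fun v hv => hA v (hsub _ hv)) (fun v hv => by
        have hne := (Finset.mem_filter.1 hv).2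
        have hle := hdeg v (hsub _ hv)
        have := Finset.card_sdiff_add_card_eq_card
          (Finset.mem_filter.1 (Finset.mem_filter.1 hv).1).2
        rw [hK.2, card_neighborFinset_eq_degree] at this
        omega)
    have h3 : 3 * (A.card * (6 * (k + 1) * 2 ^ (k + 2 + (k + 2)))) * ((2 ^ k) ^ 3 * 2 ^ 9) =
        C₁ * A.card := by rw [hC₁]; ring
    rw [h3] at h1
    nlinarith
  rcases L.eq_empty_or_nonempty with rfl | ⟨u, hu⟩
  · simp
  have hcover : L ⊆ {u} ∪ ((G.neighborFinset u).powerset.filter fun K => G.IsNClique k K).biUnion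
      fun K => L.filter fun v => K ⊆ G.neighborFinset v := by
    intro v hv
    by_cases huv : u = v
    · simp [huv]
    · obtain ⟨K, hK, hadj⟩ := h.sat u hu v huv (h.indep u hu v hv)
      refine Finset.mem_union_right _ (Finset.mem_biUnion.2 ⟨K, ?_, ?_⟩)
      · simp only [Finset.mem_filter, Finset.mem_powerset]
        exact ⟨fun q hq => by simpa using (hadj q hq).1, hK⟩
      · simp only [Finset.mem_filter]
        exact ⟨hv, fun q hq => by simpa using (hadj q hq).2⟩
  have hpow : ((G.neighborFinset u).powerset.filter fun K => G.IsNClique k K).card ≤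
      2 ^ (k + 3) := by
    refine (Finset.card_filter_le _ _).trans ?_
    rw [Finset.card_powerset]
    exact Nat.pow_le_pow_right (by norm_num) (hdeg u hu)
  calc L.card ≤ 1 + 2 ^ (k + 3) * ((C₁ + (k + 1)) * (A.card + 1)) := by
        refine (Finset.card_le_card hcover).trans ((Finset.card_union_le _ _).trans ?_)
        refine add_le_add (by simp) ((Finset.card_biUnion_le_card_mul _ _ _ fun K hK => ?_).trans
          (Nat.mul_le_mul_right _ hpow))
        exact hclique K (Finset.mem_filter.1 hK).2
    _ ≤ (1 + 2 ^ (k + 3) * (C₁ + (k + 1))) * (A.card + 1) := by nlinarith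

end LowFamily

theorem sum_degree_le_card_edgeFinset {V : Type*} [Fintype V] [DecidableEq V] (G : SimpleGraph V)
    [DecidableRel G.Adj] (B : Finset V) (hB : ∀ v ∈ B, ∀ w ∈ B, ¬ G.Adj v w) :
    ∑ v ∈ B, G.degree v ≤ G.edgeFinset.card := by
  simp_rw [← card_incidenceFinset_eq_degree]
  rw [← Finset.card_biUnion]
  · exact Finset.card_le_card (Finset.biUnion_subset.2 fun v _ => G.incidenceFinset_subset v)
  · intro v hv w hw hne
    rw [Function.onFun, Finset.disjoint_left]
    intro x hx hx'
    rw [mem_incidenceFinset] at hx hx'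
    exact hB v hv w hw (G.adj_of_mem_incidenceSet hne hx hx')

/-- Quantitative lower bound, with the high-degree threshold `D` still to be chosen. -/
theorem exists_lower_bound (k : ℕ) : ∃ C : ℕ, ∀ D : ℕ, k + 3 ≤ D → ∃ M : ℕ,
    ∀ (V : Type) [Fintype V] (G : SimpleGraph V), Ksat (k + 2) G → TwinFree G →
      ∃ a : ℕ, a * D ≤ 2 * G.edgeSet.ncard ∧
        (k + 4) * Fintype.card V ≤ G.edgeSet.ncard + (k + 4) * (C * a + M) := by
  classical
  obtain ⟨C, hC⟩ := exists_card_satFamily_le k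
  refine ⟨C + 1, fun D hD => ⟨(1 + D + D * D) * (2 ^ D + 1) ^ 2 ^ D + C, ?_⟩⟩
  intro V _ G hG htwin
  have hedge : G.edgeSet.ncard = G.edgeFinset.card := by
    rw [Set.ncard_eq_toFinset_card']
    rfl
  rw [hedge]
  let A := Finset.univ.filter fun v => D < G.degree v
  let B₁ := Finset.univ.filter fun v => G.degree v ≤ D ∧ ∃ u, G.Adj v u ∧ G.degree u ≤ D
  let B := Finset.univ.filter fun v => G.degree v ≤ D ∧ ∀ u, G.Adj v u → D < G.degree u
  let L := B.filter fun v => G.degree v ≤ k + 3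
  have hBindep : ∀ v ∈ B, ∀ w ∈ B, ¬ G.Adj v w := by
    intro v hv w hw hadj
    exact absurd ((Finset.mem_filter.1 hv).2.2 w hadj) (not_lt.2 (Finset.mem_filter.1 hw).2.1)
  have hLB : L ⊆ B := Finset.filter_subset _ _
  have hL : IsSatFamily G k L :=
    { free := (ksat_iff.1 hG).1
      sat := fun v _ w hne hadj => (ksat_iff.1 hG).2 v w hne hadj
      indep := fun v hv w hw => hBindep v (hLB hv) w (hLB hw)
      twin := fun v _ w _ hadj => htwin v w (Set.ext hadj) }
  have hLcard : L.card ≤ C * (A.card + 1) := by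
    refine hC V G L A hL (fun v hv u hu => ?_) fun v hv => (Finset.mem_filter.1 hv).2
    exact Finset.mem_filter.2 ⟨Finset.mem_univ _,
      (Finset.mem_filter.1 (hLB hv)).2.2 u (by simpa using hu)⟩
  have hB₁ : B₁.card ≤ (1 + D + D * D) * (2 ^ D + 1) ^ 2 ^ D :=
    card_low_degree_with_low_degree_neighbor hG D
  have hcover : (Finset.univ : Finset V) ⊆ A ∪ (B₁ ∪ (L ∪ (B \ L))) := by
    intro v _
    simp only [Finset.mem_union, Finset.mem_sdiff, A, B₁, B, L, Finset.mem_filter,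
      Finset.mem_univ, true_and]
    by_cases h1 : D < G.degree v
    · exact .inl h1
    by_cases h2 : ∃ u, G.Adj v u ∧ G.degree u ≤ D
    · exact .inr (.inl ⟨not_lt.1 h1, h2⟩)
    · push Not at h2
      have : G.degree v ≤ D := not_lt.1 h1
      tauto
  have hn : Fintype.card V ≤ A.card + (B₁.card + (L.card + (B \ L).card)) := by
    rw [← Finset.card_univ]
    refine (Finset.card_le_card hcover).trans ((Finset.card_union_le _ _).trans ?_)
    gcongr
    refine (Finset.card_union_le _ _).trans ?_
    gcongr
    exact Finset.card_union_le _ _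
  have hhigh : (B \ L).card * (k + 4) ≤ G.edgeFinset.card := by
    refine le_trans ?_ (sum_degree_le_card_edgeFinset G (B \ L) fun v hv w hw =>
      hBindep v (Finset.mem_sdiff.1 hv).1 w (Finset.mem_sdiff.1 hw).1)
    rw [← smul_eq_mul]
    refine Finset.card_nsmul_le_sum _ _ _ fun v hv => ?_
    have h1 := (Finset.mem_sdiff.1 hv).1
    have h2 := (Finset.mem_sdiff.1 hv).2
    simp only [L, Finset.mem_filter, not_and, not_le] at h2
    exact h2 h1
  refine ⟨A.card, ?_, by nlinarith⟩
  rw [← G.sum_degrees_eq_twice_card_edges, ← smul_eq_mul]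
  refine (Finset.card_nsmul_le_sum A (fun v => G.degree v) D fun v hv => ?_).trans
    (Finset.sum_le_sum_of_subset (Finset.subset_univ A))
  exact (Finset.mem_filter.1 hv).2.le

theorem twinFree_ksat_lower_bound {r : ℕ} (hr : 2 ≤ r) {ε : ℝ} (hε : 0 < ε) :
    ∃ N : ℕ, ∀ n : ℕ, N ≤ n → ∀ (V : Type) [Fintype V] (G : SimpleGraph V), Fintype.card V = n →
        Ksat r G → TwinFree G → ((r : ℝ) + 2 - ε) * n ≤ (G.edgeSet.ncard : ℝ) := by
  obtain ⟨k, rfl⟩ := Nat.exists_eq_add_of_le' hr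
  obtain ⟨C, hC⟩ := exists_lower_bound k
  obtain ⟨D, hD⟩ := exists_nat_ge (((k : ℝ) + 4) * C * (4 * (k + 4)) / ε)
  obtain ⟨M, hM⟩ := hC (D + (k + 3)) (by omega)
  obtain ⟨N, hN⟩ := exists_nat_ge (2 * (((k : ℝ) + 4) * M) / ε)
  refine ⟨N, fun n hn V _ G hV hG htwin => ?_⟩
  obtain ⟨a, ha, hlow⟩ := hM V G hG htwin
  rw [hV] at hlow
  set E := G.edgeSet.ncard
  have ha' : (a : ℝ) * (D + (k + 3)) ≤ 2 * E := by exact_mod_cast ha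
  have hlow' : ((k : ℝ) + 4) * n ≤ E + (k + 4) * (C * a + M) := by exact_mod_cast hlow
  have hn' : (N : ℝ) ≤ n := by exact_mod_cast hn
  rw [div_le_iff₀ hε] at hD hN
  push_cast
  by_contra! hlt
  have hE : (E : ℝ) ≤ (k + 4) * n := by nlinarith
  have hnε : N * ε ≤ n * ε := by gcongr
  have haD : (a : ℝ) * D ≤ 2 * ((k + 4) * n) := by
    have : (0 : ℝ) ≤ a * (k + 3) := by positivity
    nlinarith
  have hkey : ((k : ℝ) + 4) * (C * a) * 2 ≤ ε * n := by
    rcases Nat.eq_zero_or_pos D with rfl | hDpos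
    · have : ((k : ℝ) + 4) * C * (4 * (k + 4)) ≤ 0 := by simpa using hD
      have hC0 : (C : ℝ) ≤ 0 := by
        by_contra! hpos
        have : 0 < ((k : ℝ) + 4) * C * (4 * (k + 4)) := by positivity
        linarith
      have hC0' : (C : ℝ) = 0 := le_antisymm hC0 (by positivity)
      rw [hC0']
      simp only [zero_mul, mul_zero]
      positivity
    · have hDpos' : (0 : ℝ) < D := by exact_mod_cast hDpos
      refine le_of_mul_le_mul_right ?_ hDpos'
      calc ((k : ℝ) + 4) * (C * a) * 2 * D = ((k + 4) * C * 2) * (a * D) := by ring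
        _ ≤ ((k + 4) * C * 2) * (2 * ((k + 4) * n)) := by gcongr
        _ = (((k : ℝ) + 4) * C * (4 * (k + 4))) * n := by ring
        _ ≤ (D * ε) * n := by gcongr
        _ = ε * n * D := by ring
  linarith

section Cone

variable {V : Type*}

/-- The graph obtained by adding one vertex adjacent to everything. -/
def coneGraph (G : SimpleGraph V) : SimpleGraph (Option V) where
  Adj
    | none, none => False
    | none, some _ => True
    | some _, none => True
    | some u, some v => G.Adj u v
  symm := ⟨by rintro (_ | u) (_ | v) h <;> first | trivial | exact SimpleGraph.Adj.symm (G := G) h⟩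
  loopless := ⟨by rintro (_ | u) h; exacts [h, h.ne rfl]⟩

variable {G : SimpleGraph V} {k : ℕ}

@[simp]
theorem coneGraph_adj_some {u v : V} : (coneGraph G).Adj (some u) (some v) ↔ G.Adj u v := Iff.rfl

@[simp]
theorem coneGraph_adj_none_left {v : V} : (coneGraph G).Adj none (some v) := trivial

@[simp]
theorem coneGraph_adj_none_right {v : V} : (coneGraph G).Adj (some v) none := trivial

theorem TwinFree.coneGraph (h : TwinFree G) : TwinFree (coneGraph G) := by
  intro u v huv
  have hadj : ∀ x, (_root_.coneGraph G).Adj u x ↔ (_root_.coneGraph G).Adj v x := Set.ext_iff.1 huv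
  rcases u with _ | u <;> rcases v with _ | v
  · rfl
  · simpa using hadj (some v)
  · simpa using hadj (some u)
  · exact congrArg some (h u v (Set.ext fun x => hadj (some x)))

theorem Ksat.coneGraph (h : Ksat (k + 2) G) : Ksat (k + 3) (coneGraph G) := by
  classical
  rw [ksat_iff] at h
  rw [show k + 3 = k + 1 + 2 from rfl, ksat_iff]
  refine ⟨fun t ht => ?_, ?_⟩
  · have hsub : t ⊆ Finset.insertNone (Finset.eraseNone t) := by
      intro x hx
      rcases x with _ | x <;> simp [hx]
    have hcard := Finset.card_le_card hsub
    rw [ht.2, Finset.card_insertNone] at hcard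
    refine CliqueFree.mono (by omega : k + 2 ≤ (Finset.eraseNone t).card) h.1 _ ⟨?_, rfl⟩
    intro x hx y hy hxy
    exact ht.1 (Finset.mem_eraseNone.1 hx) (Finset.mem_eraseNone.1 hy) (by simpa using hxy)
  · rintro (_ | u) (_ | v) hne hadj
    · exact absurd rfl hne
    · exact absurd trivial hadj
    · exact absurd trivial hadj
    · obtain ⟨Q, hQ, hcommon⟩ := h.2 u v (by simpa using hne) hadj
      refine ⟨Finset.insertNone Q, ⟨?_, by simp [hQ.2]⟩, ?_⟩
      · rintro (_ | x) hx (_ | y) hy hxy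
        · exact absurd rfl hxy
        · trivial
        · trivial
        · exact hQ.1 (by simpa using hx) (by simpa using hy) (by simpa using hxy)
      · rintro (_ | q) hq
        · exact ⟨trivial, trivial⟩
        · exact hcommon q (by simpa using hq)

theorem ncard_edgeSet_coneGraph_le [Fintype V] :
    (coneGraph G).edgeSet.ncard ≤ G.edgeSet.ncard + Fintype.card V := by
  have hsub : (coneGraph G).edgeSet ⊆
      Sym2.map some '' G.edgeSet ∪ (fun v : V => s(none, some v)) '' Set.univ := by
    intro x
    induction x using Sym2.ind with
    | _ u v =>
      intro hadj
      rw [mem_edgeSet] at hadj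
      rcases u with _ | u <;> rcases v with _ | v
      · exact hadj.elim
      · exact .inr ⟨v, trivial, rfl⟩
      · exact .inr ⟨u, trivial, Sym2.eq_swap⟩
      · exact .inl ⟨s(u, v), hadj, rfl⟩
  refine (Set.ncard_le_ncard hsub (Set.toFinite _)).trans ((Set.ncard_union_le _ _).trans ?_)
  refine add_le_add (Set.ncard_image_le (Set.toFinite _)) ?_
  refine (Set.ncard_image_le (Set.toFinite _)).trans ?_
  rw [Set.ncard_univ, Nat.card_eq_fintype_card]

end Cone

section CycleBlowup

variable {α : Type*}

/-- For a set `Z` of labellings of the vertices of a pentagon: a root joined to all labellings in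
`Z`, each labelling joined to its five labelled pentagon edges, and labelled pentagon edges joined
when they disagree at a common pentagon vertex. -/
def pentagonGraph (Z : Finset (Fin 5 → α)) : SimpleGraph (Option (Z ⊕ Fin 5 × α × α)) where
  Adj
    | none, some (.inl _) => True
    | some (.inl _), none => True
    | some (.inl z), some (.inr (i, s, t)) => z.1 i = s ∧ z.1 (i + 1) = t
    | some (.inr (i, s, t)), some (.inl z) => z.1 i = s ∧ z.1 (i + 1) = t
    | some (.inr (i, s, t)), some (.inr (j, s', t')) =>
      (j = i + 1 ∧ t ≠ s') ∨ (i = j + 1 ∧ t' ≠ s)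
    | _, _ => False
  symm := ⟨by
    rintro (_ | z | ⟨i, s, t⟩) (_ | z' | ⟨j, s', t'⟩) h <;>
      first | trivial | exact h | exact Or.symm h⟩
  loopless := ⟨by
    rintro (_ | z | ⟨i, s, t⟩) h
    · exact h
    · exact h
    · have hne : ∀ i : Fin 5, i ≠ i + 1 := by decide
      rcases h with h | h <;> exact hne i h.1⟩

variable {Z : Finset (Fin 5 → α)}

theorem cliqueFree_pentagonGraph : (pentagonGraph Z).CliqueFree 3 := by
  classical
  have hcycle : ∀ i j l : Fin 5, (j = i + 1 ∨ i = j + 1) → (l = i + 1 ∨ i = l + 1) →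
      (l = j + 1 ∨ j = l + 1) → False := by decide
  intro t ht
  obtain ⟨a, b, c, hab, hac, hbc, -⟩ := is3Clique_iff.1 ht
  rcases a with _ | z₁ | ⟨i, s, t⟩ <;> rcases b with _ | z₂ | ⟨j, s', t'⟩ <;>
    rcases c with _ | z₃ | ⟨l, s'', t''⟩ <;>
    simp only [pentagonGraph] at hab hac hbc
  · grind
  · grind
  · grind
  · exact hcycle i j l (hab.imp (·.1) (·.1)) (hac.imp (·.1) (·.1)) (hbc.imp (·.1) (·.1))

theorem exists_mem_both (hZ : ∀ (f : Fin 5 → α) (m : Fin 5), ∃ z ∈ Z, ∀ l, l ≠ m → z l = f l)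
    {i j : Fin 5} (hij : i ≠ j) {s t s' t' : α} (h₁ : j = i + 1 → t = s')
    (h₂ : i = j + 1 → t' = s) :
    ∃ z ∈ Z, (z i = s ∧ z (i + 1) = t) ∧ z j = s' ∧ z (j + 1) = t' := by
  have hfree : ∀ i j : Fin 5, ∃ m, i ≠ m ∧ i + 1 ≠ m ∧ j ≠ m ∧ j + 1 ≠ m := by decide
  have hsucc : ∀ i : Fin 5, i + 1 ≠ i := by decide
  obtain ⟨m, hm₁, hm₂, hm₃, hm₄⟩ := hfree i j
  obtain ⟨z, hz, hzf⟩ := hZ (fun l => if l = i then s else if l = i + 1 then t else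
    if l = j then s' else t') m
  refine ⟨z, hz, ⟨?_, ?_⟩, ?_, ?_⟩
  · simp [hzf i hm₁]
  · simp [hzf _ hm₂, hsucc]
  · rw [hzf j hm₃]
    simp only [hij.symm, if_false, if_true]
    split_ifs with h
    · exact h₁ h
    · rfl
  · rw [hzf _ hm₄]
    simp only [add_left_inj, hij.symm, hsucc j, if_false]
    split_ifs with h
    · exact (h₂ h.symm).symm
    · rfl

theorem exists_mem_single (hZ : ∀ (f : Fin 5 → α) (m : Fin 5), ∃ z ∈ Z, ∀ l, l ≠ m → z l = f l)
    (i : Fin 5) (s t : α) : ∃ z ∈ Z, z i = s ∧ z (i + 1) = t := by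
  have hne : i ≠ i + 1 := by revert i; decide
  have hne' : i ≠ i + 1 + 1 := by revert i; decide
  obtain ⟨z, hz, h, -⟩ := exists_mem_both hZ hne (s := s) (t := t) (s' := t) (t' := t)
    (fun _ => rfl) (fun h => absurd h hne')
  exact ⟨z, hz, h⟩

theorem ksat_pentagonGraph
    (hZ : ∀ (f : Fin 5 → α) (m : Fin 5), ∃ z ∈ Z, ∀ l, l ≠ m → z l = f l)
    (hα : ∀ a b : α, ∃ c, c ≠ a ∧ c ≠ b) : Ksat 3 (pentagonGraph Z) := by
  rw [show 3 = 1 + 2 from rfl, ksat_iff]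
  refine ⟨cliqueFree_pentagonGraph, fun u v hne hadj => ?_⟩
  suffices h : ∃ q, (pentagonGraph Z).Adj u q ∧ (pentagonGraph Z).Adj v q by
    obtain ⟨q, hq⟩ := h
    exact ⟨{q}, by simp, by simpa using hq⟩
  have hlabel : ∀ (z : Z) (i : Fin 5) (s t : α), ¬ (z.1 i = s ∧ z.1 (i + 1) = t) →
      ∃ j, (pentagonGraph Z).Adj (some (.inr (i, s, t))) (some (.inr (j, z.1 j, z.1 (j + 1)))) := by
    intro z i s t hadj
    by_cases ht : z.1 (i + 1) = t
    · refine ⟨i - 1, .inr ⟨by simp, ?_⟩⟩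
      simp only [sub_add_cancel]
      tauto
    · exact ⟨i + 1, .inl ⟨rfl, Ne.symm ht⟩⟩
  rcases u with _ | z | ⟨i, s, t⟩ <;> rcases v with _ | z' | ⟨j, s', t'⟩
  · exact absurd rfl hne
  · exact absurd trivial hadj
  · obtain ⟨z, hz, h⟩ := exists_mem_single hZ j s' t'
    exact ⟨some (.inl ⟨z, hz⟩), trivial, h⟩
  · exact absurd trivial hadj
  · exact ⟨none, trivial, trivial⟩
  · obtain ⟨l, hl⟩ := hlabel z j s' t' hadj
    exact ⟨some (.inr (l, z.1 l, z.1 (l + 1))), ⟨rfl, rfl⟩, hl⟩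
  · obtain ⟨z, hz, h⟩ := exists_mem_single hZ i s t
    exact ⟨some (.inl ⟨z, hz⟩), h, trivial⟩
  · obtain ⟨l, hl⟩ := hlabel z' i s t hadj
    exact ⟨some (.inr (l, z'.1 l, z'.1 (l + 1))), hl, ⟨rfl, rfl⟩⟩
  · by_cases hij : i = j
    · subst hij
      obtain ⟨c, hc, hc'⟩ := hα t t'
      exact ⟨some (.inr (i + 1, c, c)), .inl ⟨rfl, hc.symm⟩, .inl ⟨rfl, hc'.symm⟩⟩
    · have hadj' : ¬ ((j = i + 1 ∧ t ≠ s') ∨ (i = j + 1 ∧ t' ≠ s)) := hadj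
      obtain ⟨z, hz, h, h'⟩ := exists_mem_both hZ hij (s := s) (t := t) (s' := s') (t' := t')
        (fun h => by tauto) (fun h => by tauto)
      exact ⟨some (.inl ⟨z, hz⟩), h, h'⟩

theorem twinFree_pentagonGraph
    (hZ : ∀ (f : Fin 5 → α) (m : Fin 5), ∃ z ∈ Z, ∀ l, l ≠ m → z l = f l)
    (hα : ∀ a b : α, ∃ c, c ≠ a ∧ c ≠ b) : TwinFree (pentagonGraph Z) := by
  intro u v huv
  have hadj : ∀ x, (pentagonGraph Z).Adj u x ↔ (pentagonGraph Z).Adj v x := Set.ext_iff.1 huv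
  have hroot : ∀ i s t, ¬ ∀ x, (pentagonGraph Z).Adj none x ↔
      (pentagonGraph Z).Adj (some (.inr (i, s, t))) x := by
    intro i s t h
    obtain ⟨c, hc, -⟩ := hα s s
    obtain ⟨z, hz, hzi, -⟩ := exists_mem_single hZ i c t
    have hzs : z i = s ∧ z (i + 1) = t := (h (some (.inl ⟨z, hz⟩))).1 trivial
    exact hc (hzi.symm.trans hzs.1)
  rcases u with _ | z | ⟨i, s, t⟩ <;> rcases v with _ | z' | ⟨j, s', t'⟩
  · rfl
  · exact ((hadj (some (.inl z'))).1 trivial).elim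
  · exact absurd hadj (hroot j s' t')
  · exact ((hadj (some (.inl z))).2 trivial).elim
  · have hzz' : z = z' := by
      refine Subtype.ext (funext fun m => ?_)
      have h : z'.1 m = z.1 m ∧ z'.1 (m + 1) = z.1 (m + 1) :=
        (hadj (some (.inr (m, z.1 m, z.1 (m + 1))))).1 ⟨rfl, rfl⟩
      exact h.1.symm
    rw [hzz']
  · exact ((hadj none).1 trivial).elim
  · exact absurd (fun x => (hadj x).symm) (hroot i s t)
  · exact ((hadj none).2 trivial).elim
  · have hlabel : ∀ z ∈ Z, z i = s → z (i + 1) = t → z j = s' ∧ z (j + 1) = t' := fun z hz h h' =>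
      (hadj (some (.inl ⟨z, hz⟩))).1 ⟨h, h'⟩
    by_cases hij : i = j
    · subst hij
      obtain ⟨z, hz, h₁, h₂⟩ := exists_mem_single hZ i s t
      obtain ⟨h₃, h₄⟩ := hlabel z hz h₁ h₂
      rw [← h₁, ← h₂, ← h₃, ← h₄]
    exfalso
    by_cases hji : j = i + 1
    · subst hji
      have hne : ∀ i : Fin 5, i ≠ i + 1 + 1 := by decide
      obtain ⟨c, hc, -⟩ := hα t' t'
      obtain ⟨z, hz, h, h'⟩ := exists_mem_both hZ hij (s := s) (t := t) (s' := t) (t' := c)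
        (fun _ => rfl) (fun h => absurd h (hne i))
      exact hc (h'.2.symm.trans (hlabel z hz h.1 h.2).2)
    · obtain ⟨c, hc, -⟩ := hα s' s'
      obtain ⟨z, hz, h, h'⟩ := exists_mem_both hZ hij (s := s) (t := t) (s' := c) (t' := s)
        (fun h => absurd h hji) (fun _ => rfl)
      exact hc (h'.1.symm.trans (hlabel z hz h.1 h.2).1)

theorem ncard_edgeSet_pentagonGraph_le [Fintype α] :
    (pentagonGraph Z).edgeSet.ncard ≤ 6 * Z.card + 5 * Fintype.card α ^ 4 := by
  let φ : (Z × Option (Fin 5)) ⊕ (Fin 5 × α × α × α × α) → Sym2 (Option (Z ⊕ Fin 5 × α × α))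
    | .inl (z, none) => s(some (.inl z), none)
    | .inl (z, some i) => s(some (.inl z), some (.inr (i, z.1 i, z.1 (i + 1))))
    | .inr (i, s, t, s', t') => s(some (.inr (i, s, t)), some (.inr (i + 1, s', t')))
  have hsub : (pentagonGraph Z).edgeSet ⊆ φ '' Set.univ := by
    intro x
    induction x using Sym2.ind with
    | _ u v =>
      intro hadj
      rw [mem_edgeSet] at hadj
      rcases u with _ | z | ⟨i, s, t⟩ <;> rcases v with _ | z' | ⟨j, s', t'⟩
      · exact hadj.elim
      · exact ⟨.inl (z', none), trivial, Sym2.eq_swap⟩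
      · exact hadj.elim
      · exact ⟨.inl (z, none), trivial, rfl⟩
      · exact hadj.elim
      · obtain ⟨rfl, rfl⟩ := hadj
        exact ⟨.inl (z, some j), trivial, rfl⟩
      · exact hadj.elim
      · obtain ⟨rfl, rfl⟩ := hadj
        exact ⟨.inl (z', some i), trivial, Sym2.eq_swap⟩
      · rcases hadj with ⟨rfl, -⟩ | ⟨rfl, -⟩
        · exact ⟨.inr (i, s, t, s', t'), trivial, rfl⟩
        · exact ⟨.inr (j, s', t', s, t), trivial, Sym2.eq_swap⟩
  refine (Set.ncard_le_ncard hsub (Set.toFinite _)).trans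
    ((Set.ncard_image_le (Set.toFinite _)).trans ?_)
  rw [Set.ncard_univ, Nat.card_eq_fintype_card]
  simp only [Fintype.card_sum, Fintype.card_prod, Fintype.card_coe, Fintype.card_option,
    Fintype.card_fin]
  apply le_of_eq
  ring

theorem card_pentagonGraph_vertices [Fintype α] :
    Fintype.card (Option (Z ⊕ Fin 5 × α × α)) = Z.card + 5 * Fintype.card α ^ 2 + 1 := by
  simp only [Fintype.card_sum, Fintype.card_prod, Fintype.card_coe, Fintype.card_option,
    Fintype.card_fin]
  ring

end CycleBlowup

theorem exists_labellings (q N : ℕ) [NeZero q] (h₁ : q ^ 4 ≤ N) (h₂ : N ≤ q ^ 5) :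
    ∃ Z : Finset (Fin 5 → ZMod q), Z.card = N ∧
      ∀ (f : Fin 5 → ZMod q) (m : Fin 5), ∃ z ∈ Z, ∀ l, l ≠ m → z l = f l := by
  let Z₀ : Finset (Fin 5 → ZMod q) :=
    Finset.univ.image fun g : Fin 4 → ZMod q => Fin.cons (-∑ i, g i) g
  have hcard : Z₀.card ≤ N := by
    refine Finset.card_image_le.trans (le_trans (le_of_eq ?_) h₁)
    simp [Finset.card_univ, ZMod.card]
  obtain ⟨Z, hZ₀, -, hZ⟩ := Finset.exists_subsuperset_card_eq (Finset.subset_univ Z₀) hcard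
    (by simpa [Finset.card_univ, ZMod.card] using h₂)
  have hmem : ∀ z : Fin 5 → ZMod q, ∑ l, z l = 0 → z ∈ Z₀ := by
    intro z hz
    rw [Fin.sum_univ_succ] at hz
    refine Finset.mem_image.2 ⟨Fin.tail z, Finset.mem_univ _, ?_⟩
    have h : -∑ i, Fin.tail z i = z 0 := (eq_neg_of_add_eq_zero_left hz).symm
    rw [h, Fin.cons_self_tail]
  exact ⟨Z, hZ, fun f m => ⟨f - Pi.single m (∑ i, f i),
    hZ₀ (hmem _ (by simp [Finset.sum_sub_distrib])), fun l hl => by simp [hl]⟩⟩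

theorem exists_pow_le_lt (n d : ℕ) (hd : d ≠ 0) : ∃ p : ℕ, p ^ d ≤ n ∧ n < (p + 1) ^ d := by
  have hex : ∃ p, n < (p + 1) ^ d :=
    ⟨n, (Nat.lt_succ_self n).trans_le (Nat.le_self_pow hd _)⟩
  refine ⟨Nat.find hex, ?_, Nat.find_spec hex⟩
  rcases hp : Nat.find hex with _ | p
  · simp [hd]
  · exact not_lt.1 (Nat.find_min hex (by omega : p < Nat.find hex))

theorem exists_twinFree_ksat_three {ε : ℝ} (hε : 0 < ε) :
    ∃ N : ℕ, ∀ n : ℕ, N ≤ n → ∃ (V : Type) (_ : Fintype V) (G : SimpleGraph V),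
      Fintype.card V = n ∧ Ksat 3 G ∧ TwinFree G ∧ (G.edgeSet.ncard : ℝ) ≤ (6 + ε) * n := by
  obtain ⟨P, hP⟩ := exists_nat_ge (80 / ε)
  refine ⟨(P + 37) ^ 5, fun n hn => ?_⟩
  obtain ⟨p, hpn, hnp⟩ := exists_pow_le_lt n 5 (by norm_num)
  have hpP : P + 37 ≤ p := by
    by_contra! hlt
    exact absurd (Nat.pow_le_pow_left (by omega : p + 1 ≤ P + 37) 5) (by omega)
  have hq4 : (p + 1) ^ 4 ≤ 16 * p ^ 4 :=
    (Nat.pow_le_pow_left (by omega : p + 1 ≤ 2 * p) 4).trans (by ring_nf; rfl)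
  have hq2 : (p + 1) ^ 2 ≤ 4 * p ^ 4 := by
    refine (Nat.pow_le_pow_left (by omega : p + 1 ≤ 2 * p) 2).trans ?_
    have : p ^ 2 ≤ p ^ 4 := Nat.pow_le_pow_right (by omega) (by norm_num)
    nlinarith
  have hp4 : 1 ≤ p ^ 4 := Nat.one_le_pow _ _ (by omega)
  have hp5 : (P + 37) * p ^ 4 ≤ p ^ 5 := by
    rw [pow_succ' p 4]
    exact Nat.mul_le_mul_right _ hpP
  have hlow : (p + 1) ^ 4 + 5 * (p + 1) ^ 2 + 1 ≤ n := by nlinarith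
  obtain ⟨Z, hZcard, hZ⟩ := exists_labellings (p + 1) (n - 5 * (p + 1) ^ 2 - 1) (by omega)
    (by omega)
  have hα : ∀ a b : ZMod (p + 1), ∃ c, c ≠ a ∧ c ≠ b := by
    intro a b
    obtain ⟨c, hc⟩ := Finset.exists_mem_notMem_of_card_lt_card (s := {a, b})
      (t := (Finset.univ : Finset (ZMod (p + 1))))
      (Finset.card_le_two.trans_lt (by rw [Finset.card_univ, ZMod.card]; omega))
    simp only [Finset.mem_insert, Finset.mem_singleton, not_or] at hc
    exact ⟨c, hc.2⟩
  refine ⟨_, inferInstance, pentagonGraph Z, ?_, ksat_pentagonGraph hZ hα,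
    twinFree_pentagonGraph hZ hα, ?_⟩
  · rw [card_pentagonGraph_vertices, ZMod.card, hZcard]
    omega
  · have hedge := ncard_edgeSet_pentagonGraph_le (Z := Z)
    rw [ZMod.card] at hedge
    have hedge' : (pentagonGraph Z).edgeSet.ncard ≤ 6 * n + 80 * p ^ 4 := by omega
    have hreal : ((pentagonGraph Z).edgeSet.ncard : ℝ) ≤ 6 * n + 80 * (p : ℝ) ^ 4 := by
      exact_mod_cast hedge'
    rw [div_le_iff₀ hε] at hP
    have hPn : (P : ℝ) * (p : ℝ) ^ 4 ≤ n := by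
      have : P * p ^ 4 ≤ n := by nlinarith
      exact_mod_cast this
    have h80 : 80 * (p : ℝ) ^ 4 ≤ ε * n :=
      calc 80 * (p : ℝ) ^ 4 ≤ (P * ε) * (p : ℝ) ^ 4 := by gcongr
        _ = ε * (P * (p : ℝ) ^ 4) := by ring
        _ ≤ ε * n := by gcongr
    linarith

theorem exists_twinFree_ksat (j : ℕ) {ε : ℝ} (hε : 0 < ε) :
    ∃ N : ℕ, ∀ n : ℕ, N ≤ n → ∃ (V : Type) (_ : Fintype V) (G : SimpleGraph V),
      Fintype.card V = n ∧ Ksat (j + 3) G ∧ TwinFree G ∧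
        (G.edgeSet.ncard : ℝ) ≤ (j + 6 + ε) * n := by
  induction j with
  | zero => simpa using exists_twinFree_ksat_three hε
  | succ j ih =>
    obtain ⟨N, hN⟩ := ih
    refine ⟨N + 1, fun n hn => ?_⟩
    obtain ⟨n, rfl⟩ := Nat.exists_eq_add_of_le' (Nat.le_of_add_left_le hn)
    obtain ⟨V, _, G, hcard, hsat, htwin, hedge⟩ := hN n (by omega)
    refine ⟨Option V, inferInstance, coneGraph G, by simp [hcard], hsat.coneGraph,
      htwin.coneGraph, ?_⟩
    have h : ((coneGraph G).edgeSet.ncard : ℝ) ≤ G.edgeSet.ncard + n := by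
      have := ncard_edgeSet_coneGraph_le (G := G)
      rw [hcard] at this
      exact_mod_cast this
    push_cast
    have : (0 : ℝ) ≤ j := by positivity
    nlinarith

section Transfer

variable {V W : Type*} {G : SimpleGraph V}

theorem Ksat.comap_equiv {k : ℕ} (h : Ksat (k + 2) G) (e : W ≃ V) : Ksat (k + 2) (G.comap e) := by
  rw [ksat_iff] at h ⊢
  refine ⟨h.1.comap ⟨(Iso.comap e G).toEmbedding.toCopy⟩, fun u v hne hadj => ?_⟩
  obtain ⟨Q, hQ, hcommon⟩ := h.2 (e u) (e v) (e.injective.ne hne) hadj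
  refine ⟨Q.map e.symm.toEmbedding, ⟨?_, by simp [hQ.2]⟩, ?_⟩
  · intro x hx y hy hxy
    simp only [Finset.coe_map, Equiv.coe_toEmbedding, Set.mem_image, Finset.mem_coe] at hx hy
    obtain ⟨x, hx, rfl⟩ := hx
    obtain ⟨y, hy, rfl⟩ := hy
    simpa using hQ.1 hx hy fun hxy' => hxy (hxy' ▸ rfl)
  · intro q hq
    obtain ⟨q', hq', rfl⟩ := Finset.mem_map.1 hq
    simpa using hcommon q' hq'

theorem TwinFree.comap_equiv (h : TwinFree G) (e : W ≃ V) : TwinFree (G.comap e) := by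
  intro u v huv
  refine e.injective (h _ _ (Set.ext fun x => ?_))
  simpa using Set.ext_iff.1 huv (e.symm x)

theorem ncard_edgeSet_comap_equiv (e : W ≃ V) : (G.comap e).edgeSet.ncard = G.edgeSet.ncard :=
  Nat.card_congr (Iso.comap e G).mapEdgeSet

end Transfer

/-- `(r+2)n + o(n) ≤ tsat(n, K_r) ≤ (r+3)n + o(n)` for `r ≥ 3`. -/
theorem stmt1 (r : ℕ) (hr : 3 ≤ r) (ε : ℝ) (hε : 0 < ε) :
    ∃ N : ℕ, ∀ n : ℕ, N ≤ n →
      (∀ (V : Type) [Fintype V] (G : SimpleGraph V), Fintype.card V = n →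
        Ksat r G → TwinFree G → ((r : ℝ) + 2 - ε) * n ≤ (G.edgeSet.ncard : ℝ)) ∧
      (∃ G : SimpleGraph (Fin n), Ksat r G ∧ TwinFree G ∧
        (G.edgeSet.ncard : ℝ) ≤ ((r : ℝ) + 3 + ε) * n) := by
  obtain ⟨N₁, hN₁⟩ := twinFree_ksat_lower_bound (by omega : 2 ≤ r) hε
  obtain ⟨j, rfl⟩ := Nat.exists_eq_add_of_le' hr
  obtain ⟨N₂, hN₂⟩ := exists_twinFree_ksat j hε
  refine ⟨max N₁ N₂, fun n hn => ⟨hN₁ n (le_of_max_le_left hn), ?_⟩⟩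
  obtain ⟨V, _, G, hcard, hsat, htwin, hedge⟩ := hN₂ n (le_of_max_le_right hn)
  let e : Fin n ≃ V := (Fintype.equivFinOfCardEq hcard).symm
  refine ⟨G.comap e, Ksat.comap_equiv (k := j + 1) hsat e, htwin.comap_equiv e, ?_⟩
  rw [ncard_edgeSet_comap_equiv]
  push_cast
  linarith
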